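/- Let L₄ be the linear differential operator on ℂ[t] defined by L₄(y) := y⁽⁵⁾ − 20·t·y''' − 30·y'' + 64·t²·y' + 64·t·y. Then there is no polynomial y ∈ ℂ[t] with L₄(y) = 12 (the constant polynomial 12). -/

import Mathlib

open Polynomial

/-- The operator `L₄ = ∂⁵ − 20t∂³ − 30∂² + 64t²∂ + 64t` (the fourth symmetric power of the
Airy operator `∂² − t`) on `ℂ[t]`. -/
noncomputable def L₄ (y : Polynomial ℂ) : Polynomial ℂ :=
  derivative (derivative (derivative (derivative (derivative y))))
    - 20 * X * derivative (derivative (derivative y))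
    - 30 * derivative (derivative y)
    + 64 * X ^ 2 * derivative y
    + 64 * X * y

theorem coeff_X_mul_derivative {R : Type*} [CommSemiring R] (p : Polynomial R) (n : ℕ) :
    (X * derivative p).coeff n = n * p.coeff n := by
  cases n with
  | zero => simp
  | succ n => rw [coeff_X_mul, coeff_derivative]; push_cast; ring

/-- `L₄` raises the degree by one, multiplying the leading coefficient by `64 (deg y + 1)`. -/
theorem coeff_L₄_natDegree_succ (y : Polynomial ℂ) :
    (L₄ y).coeff (y.natDegree + 1) = 64 * (y.natDegree + 1) * y.leadingCoeff := by
  have hy (k : ℕ) (hk : 0 < k) : y.coeff (y.natDegree + k) = 0 :=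
    coeff_eq_zero_of_natDegree_lt (by lia)
  have hL : L₄ y = derivative (derivative (derivative (derivative (derivative y))))
      - C 20 * (X * derivative (derivative (derivative y)))
      - C 30 * derivative (derivative y)
      + C 64 * (X * (X * derivative y)) + C 64 * (X * y) := by
    simp only [L₄, map_ofNat]
    ring
  rw [hL]
  simp only [coeff_add, coeff_sub, coeff_C_mul, coeff_X_mul, coeff_X_mul_derivative,
    coeff_derivative, add_assoc, Nat.reduceAdd, hy, Nat.ofNat_pos, coeff_natDegree]
  ring

/-- No polynomial `y ∈ ℂ[t]` satisfies `L₄(y) = 12`. -/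
theorem stmt_7 : ¬ ∃ y : Polynomial ℂ, L₄ y = 12 := by
  rintro ⟨y, hy⟩
  have h := coeff_L₄_natDegree_succ y
  rw [hy, coeff_ofNat_succ, zero_eq_mul, leadingCoeff_eq_zero] at h
  rcases h with h | rfl
  · exact mul_ne_zero (by norm_num) (Nat.cast_add_one_ne_zero y.natDegree) h
  · simp [L₄] at hy
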